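/- Let σ_n > 0, let N be a positive integer, and let s : Fin N → ℝ satisfy 0 ≤ s_k ≤ 1 for every k. Then ∑_{k} s_k ≤ (2 / log(1 + σ_n⁻²)) · (1/2)·∑_{k} log(1 + σ_n⁻²·s_k). -/

import Mathlib

open Finset

/-- Concavity of `x ↦ log (1 + a * x)` on `[0, 1]`, as a chord bound. -/
theorem mul_log_one_add_le_log_one_add_mul {a x : ℝ} (ha : 0 ≤ a) (hx₀ : 0 ≤ x) (hx₁ : x ≤ 1) :
    x * Real.log (1 + a) ≤ Real.log (1 + a * x) := by
  have h : (1 + a) ^ x ≤ 1 + x * a :=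
    rpow_one_add_le_one_add_mul_self (by linarith) hx₀ hx₁
  rw [← Real.log_rpow (by linarith), mul_comm a]
  exact Real.log_le_log (by positivity) h

/-- Information-theoretic bound on cumulative variances: for `σ_n > 0` and
`0 ≤ s_k ≤ 1` for all `k`,
`∑ s_k ≤ (2 / log(1 + σ_n⁻²)) · (1/2)·∑ log(1 + σ_n⁻²·s_k)`. -/
theorem sum_le_info_gain_bound
    (σn : ℝ) (hσn : 0 < σn) (N : ℕ) (hN : 0 < N)
    (s : Fin N → ℝ) (hs : ∀ k, 0 ≤ s k ∧ s k ≤ 1) :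
    ∑ k : Fin N, s k ≤
      (2 / Real.log (1 + (σn ^ 2)⁻¹)) *
        ((1 / 2) * ∑ k : Fin N, Real.log (1 + (σn ^ 2)⁻¹ * s k)) := by
  have ha : 0 < (σn ^ 2)⁻¹ := by positivity
  have hlog : 0 < Real.log (1 + (σn ^ 2)⁻¹) := Real.log_pos (by linarith)
  have hsum : (∑ k, s k) * Real.log (1 + (σn ^ 2)⁻¹) ≤
      ∑ k, Real.log (1 + (σn ^ 2)⁻¹ * s k) := by
    rw [sum_mul]
    exact sum_le_sum fun k _ => mul_log_one_add_le_log_one_add_mul ha.le (hs k).1 (hs k).2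
  calc ∑ k, s k
      ≤ (∑ k, Real.log (1 + (σn ^ 2)⁻¹ * s k)) / Real.log (1 + (σn ^ 2)⁻¹) :=
        (le_div_iff₀ hlog).2 hsum
    _ = _ := by ring
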